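/- arXiv:1307.1356 — 2 statements merged into one kernel-verified Lean document; each statement's English description precedes it below -/
import Mathlib

section
/- Let p be a prime number and let n be a natural number. Let C be a cochain complex of abelian groups indexed by the natural numbers such that C^i = 0 for all i > n, each C^i has no p-torsion, and each cohomology group H^i(C) is a finitely generated abelian group. Then each H^i(C ⊗_ℤ 𝔽_p) is a finite-dimensional 𝔽_p-vector space and Σ_{i≥0} (-1)^i dim_ℚ (H^i(C) ⊗_ℤ ℚ) = Σ_{i≥0} (-1)^i dim_{𝔽_p} H^i(C ⊗_ℤ 𝔽_p). -/
open TensorProduct Module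

section ComplexMachinery

variable (C : ℕ → Type*) [∀ i, AddCommGroup (C i)] (d : ∀ i, C i →+ C (i + 1))

/-- The coboundaries of a (ℕ-indexed) cochain complex of abelian groups:
`B^0 = 0` and `B^{i+1} = range (d^i)`. -/
def coboundaries : ∀ i : ℕ, AddSubgroup (C i)
  | 0 => ⊥
  | (i + 1) => (d i).range

/-- The `i`-th cohomology group of a (ℕ-indexed) cochain complex of abelian groups:
`H^i = ker(d^i) / B^i`. -/
def cohomology (i : ℕ) : Type _ :=
  (d i).ker ⧸ (coboundaries C d i).addSubgroupOf (d i).ker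

instance (i : ℕ) : AddCommGroup (cohomology C d i) :=
  inferInstanceAs (AddCommGroup (_ ⧸ _))

variable (p : ℕ)

/-- The terms of the mod `p` reduction `C ⊗_ℤ 𝔽_p` of the complex `C`
(written with the tensor factors in the order `𝔽_p ⊗_ℤ C^i`). -/
abbrev modpTerm (i : ℕ) : Type _ := ZMod p ⊗[ℤ] C i

/-- The differential of the mod `p` reduction of the complex `C`, as a map of
`𝔽_p`-vector spaces. -/
noncomputable def modpD (i : ℕ) : modpTerm C p i →ₗ[ZMod p] modpTerm C p (i + 1) :=
  (TensorProduct.map LinearMap.id (d i).toIntLinearMap).toAddMonoidHom.toZModLinearMap p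

/-- The coboundaries of the mod `p` reduction of the complex `C`. -/
noncomputable def modpCoboundaries : ∀ i : ℕ, Submodule (ZMod p) (modpTerm C p i)
  | 0 => ⊥
  | (i + 1) => LinearMap.range (modpD C d p i)

/-- The `i`-th cohomology of the mod `p` reduction `C ⊗_ℤ 𝔽_p` of the complex `C`,
an `𝔽_p`-vector space. -/
noncomputable def modpCohomology (i : ℕ) : Type _ :=
  LinearMap.ker (modpD C d p i) ⧸
    (modpCoboundaries C d p i).comap (LinearMap.ker (modpD C d p i)).subtype

noncomputable instance (i : ℕ) : AddCommGroup (modpCohomology C d p i) :=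
  inferInstanceAs (AddCommGroup (_ ⧸ _))

noncomputable instance (i : ℕ) : Module (ZMod p) (modpCohomology C d p i) :=
  inferInstanceAs (Module (ZMod p) (_ ⧸ _))

end ComplexMachinery

theorem finrank_int_eq_of_addEquiv_prod {H F T : Type*} [AddCommGroup H] [AddCommGroup F]
    [AddCommGroup T] [Module.Free ℤ F] [Module.Finite ℤ F] [Finite T] (e : H ≃+ F × T) :
    finrank ℤ H = finrank ℤ F := by
  have : Module.Finite ℤ T := Module.Finite.of_finite
  have : Module.Finite ℤ H := Module.Finite.equiv e.toIntLinearEquiv.symm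
  let f : H →ₗ[ℤ] F := LinearMap.fst ℤ F T ∘ₗ e.toIntLinearEquiv.toLinearMap
  have hf : Function.Surjective f := Prod.fst_surjective.comp e.surjective
  have hinj : Function.Injective fun x : LinearMap.ker f => (e x).2 := fun x y h =>
    Subtype.ext <| e.injective <| Prod.ext
      ((LinearMap.mem_ker.1 x.2).trans (LinearMap.mem_ker.1 y.2).symm) h
  have : Finite (LinearMap.ker f) := Finite.of_injective _ hinj
  have htors : Module.IsTorsion ℤ (LinearMap.ker f) := fun x =>
    ⟨⟨Nat.card (LinearMap.ker f), mem_nonZeroDivisors_of_ne_zero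
      (Nat.cast_ne_zero.2 Nat.card_pos.ne')⟩, by
      simpa [Submonoid.smul_def, natCast_zsmul] using! card_nsmul_eq_zero' (x := x)⟩
  rw [← (LinearMap.ker f).finrank_quotient_add_finrank, htors.finrank_eq_zero, add_zero,
    (f.quotKerEquivOfSurjective hf).finrank_eq]

theorem index_range_nsmul_of_finite (T : Type*) [AddCommGroup T] [Finite T] (m : ℕ) :
    (nsmulAddMonoidHom (α := T) m).range.index = Nat.card (nsmulAddMonoidHom (α := T) m).ker := by
  have h₁ := (nsmulAddMonoidHom (α := T) m).range.card_mul_index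
  have h₂ := (nsmulAddMonoidHom (α := T) m).ker.card_mul_index
  rw [AddSubgroup.index_ker] at h₂
  have : 0 < Nat.card (nsmulAddMonoidHom (α := T) m).range := Nat.card_pos
  nlinarith

theorem index_range_nsmul_of_addEquiv_prod {H F T : Type*} [AddCommGroup H] [AddCommGroup F]
    [AddCommGroup T] [Module.Free ℤ F] [Module.Finite ℤ F] [Finite T] (e : H ≃+ F × T)
    {m : ℕ} (hm : m ≠ 0) :
    (nsmulAddMonoidHom (α := H) m).range.index =
      m ^ finrank ℤ F * Nat.card (nsmulAddMonoidHom (α := H) m).ker := by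
  have hrange : (nsmulAddMonoidHom (α := F × T) m).range =
      (nsmulAddMonoidHom (α := F) m).range.prod (nsmulAddMonoidHom (α := T) m).range := by
    ext x
    simp [AddSubgroup.mem_prod, Prod.ext_iff]
  have hker : Nat.card (nsmulAddMonoidHom (α := H) m).ker =
      Nat.card (nsmulAddMonoidHom (α := T) m).ker := by
    refine Nat.card_congr (Equiv.ofBijective
      (fun x => ⟨(e x).2, by simpa [AddMonoidHom.mem_ker] using congr_arg (fun y => (e y).2) x.2⟩)
      ⟨fun x y h => ?_, fun t => ?_⟩)
    · have hfst (z : (nsmulAddMonoidHom (α := H) m).ker) : (e z).1 = 0 := by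
        have : m • (e z).1 = 0 := by simpa using congr_arg (fun y => (e y).1) z.2
        exact AddSubgroup.nsmulAddMonoidHom_injective_of_isTorsionFree hm (by simpa using this)
      exact Subtype.ext <| e.injective <| Prod.ext ((hfst x).trans (hfst y).symm)
        (congr_arg Subtype.val h)
    · refine ⟨⟨e.symm (0, t), ?_⟩, by simp⟩
      have : m • (t : T) = 0 := t.2
      rw [AddMonoidHom.mem_ker, nsmulAddMonoidHom_apply, ← map_nsmul, Prod.smul_mk, this]
      simp
  rw [hker, ← AddSubgroup.index_map_equiv _ e, AddEquiv.map_range_nsmulAddMonoidHom, hrange,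
    AddSubgroup.index_prod, AddSubgroup.index_range_nsmul, index_range_nsmul_of_finite]

theorem index_range_nsmul_of_fg (H : Type*) [AddCommGroup H] [AddGroup.FG H] {m : ℕ}
    (hm : m ≠ 0) :
    (nsmulAddMonoidHom (α := H) m).range.index =
      m ^ finrank ℚ (ℚ ⊗[ℤ] H) * Nat.card (nsmulAddMonoidHom (α := H) m).ker := by
  obtain ⟨r, ι, _, q, hq, k, ⟨e⟩⟩ := AddCommGroup.equiv_free_prod_directSum_zmod H
  have (i : ι) : NeZero (q i ^ k i) := ⟨pow_ne_zero _ (hq i).ne_zero⟩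
  have : Finite (DirectSum ι fun i => ZMod (q i ^ k i)) :=
    Finite.of_equiv _ DFinsupp.equivFunOnFintype.symm
  have h := IsLocalizedModule.finrank_eq (nonZeroDivisors ℤ) (TensorProduct.mk ℤ ℚ H 1) le_rfl
  rw [index_range_nsmul_of_addEquiv_prod e hm,
    (IsLocalization.finrank_eq ℚ (nonZeroDivisors ℤ) le_rfl).trans h,
    finrank_int_eq_of_addEquiv_prod e]

theorem finite_ker_nsmul_of_fg (H : Type*) [AddCommGroup H] [AddGroup.FG H] {m : ℕ}
    (hm : m ≠ 0) : Finite (nsmulAddMonoidHom (α := H) m).ker := by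
  have : Module.Finite ℤ H := Module.Finite.iff_addGroup_fg.2 ‹_›
  have : Module.Finite ℤ (AddSubgroup.toIntSubmodule (nsmulAddMonoidHom (α := H) m).ker) :=
    inferInstance
  exact Module.finite_of_fg_torsion (AddSubgroup.toIntSubmodule (nsmulAddMonoidHom (α := H) m).ker)
    fun x => ⟨⟨m, mem_nonZeroDivisors_of_ne_zero (Nat.cast_ne_zero.2 hm)⟩, by
      have : m • (x : H) = 0 := x.2
      exact Subtype.ext (by simpa [Submonoid.smul_def, natCast_zsmul] using this)⟩

theorem one_tmul_eq_zero_iff (m : ℕ) {A : Type*} [AddCommGroup A] (x : A) :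
    (1 : ZMod m) ⊗ₜ[ℤ] x = 0 ↔ ∃ y, m • y = x := by
  let e : (ℤ ⧸ Ideal.span {(m : ℤ)}) ≃ₗ[ℤ] ZMod m :=
    (Int.quotientSpanNatEquivZMod m).toAddEquiv.toIntLinearEquiv
  have he : e 1 = 1 := map_one (Int.quotientSpanNatEquivZMod m)
  have hcongr : TensorProduct.congr e (LinearEquiv.refl ℤ A) (1 ⊗ₜ x) = 1 ⊗ₜ x := by
    rw [TensorProduct.congr_tmul, he, LinearEquiv.refl_apply]
  rw [← hcongr, LinearEquiv.map_eq_zero_iff, ← TensorProduct.mk_apply, ← LinearMap.mem_ker]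
  erw [LinearMap.ker_tensorProductMk]
  simp [Submodule.ideal_span_singleton_smul,
    Submodule.mem_smul_pointwise_iff_exists]

theorem one_tmul_surjective (m : ℕ) (A : Type*) [AddCommGroup A] :
    Function.Surjective fun x : A => (1 : ZMod m) ⊗ₜ[ℤ] x := by
  intro t
  induction t with
  | zero => exact ⟨0, TensorProduct.tmul_zero _ _⟩
  | tmul a x =>
    obtain ⟨k, rfl⟩ := ZMod.intCast_surjective a
    exact ⟨k • x, by simp only [← TensorProduct.smul_tmul, zsmul_one]⟩
  | add s t hs ht =>
    obtain ⟨x, rfl⟩ := hs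
    obtain ⟨y, rfl⟩ := ht
    exact ⟨x + y, TensorProduct.tmul_add _ _ _⟩

theorem exists_natCard_ker_nsmul_eq_pow (H : Type*) [AddCommGroup H] [AddGroup.FG H] (p : ℕ)
    [Fact p.Prime] : ∃ t, Nat.card (nsmulAddMonoidHom (α := H) p).ker = p ^ t := by
  have := finite_ker_nsmul_of_fg H (NeZero.ne p)
  let : Module (ZMod p) (nsmulAddMonoidHom (α := H) p).ker :=
    AddCommGroup.zmodModule fun x => Subtype.ext x.2
  have : Module.Finite (ZMod p) (nsmulAddMonoidHom (α := H) p).ker := Module.Finite.of_finite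
  exact ⟨finrank (ZMod p) (nsmulAddMonoidHom (α := H) p).ker, by
    rw [Module.natCard_eq_pow_finrank (K := ZMod p), Nat.card_zmod]⟩

section CochainComplex

variable {C : ℕ → Type*} [∀ i, AddCommGroup (C i)] {d : ∀ i, C i →+ C (i + 1)}

theorem coboundaries_le_ker (hdd : ∀ i (x : C i), d (i + 1) (d i x) = 0) (i : ℕ) :
    coboundaries C d i ≤ (d i).ker := by
  cases i with
  | zero => exact bot_le
  | succ i =>
    rintro _ ⟨x, rfl⟩
    exact hdd i x

variable (d) in
/-- The quotient map from cocycles to cohomology. -/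
def cohomologyMk (i : ℕ) : (d i).ker →+ cohomology C d i :=
  QuotientAddGroup.mk' ((coboundaries C d i).addSubgroupOf (d i).ker)

theorem cohomologyMk_surjective (i : ℕ) : Function.Surjective (cohomologyMk d i) :=
  QuotientAddGroup.mk'_surjective _

theorem cohomologyMk_eq_zero_iff {i : ℕ} (z : (d i).ker) :
    cohomologyMk d i z = 0 ↔ (z : C i) ∈ coboundaries C d i :=
  QuotientAddGroup.eq_zero_iff z

variable {p : ℕ}

theorem modpD_one_tmul (i : ℕ) (x : C i) :
    modpD C d p i ((1 : ZMod p) ⊗ₜ x) = (1 : ZMod p) ⊗ₜ d i x := rfl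

theorem one_tmul_mem_modpCoboundaries_iff {i : ℕ} (x : C i) :
    (1 : ZMod p) ⊗ₜ x ∈ modpCoboundaries C d p i ↔
      ∃ b ∈ coboundaries C d i, ∃ w, x = b + p • w := by
  cases i with
  | zero =>
    refine (one_tmul_eq_zero_iff p x).trans ⟨fun ⟨y, hy⟩ => ⟨0, zero_mem _, y, by simp [hy]⟩, ?_⟩
    rintro ⟨b, rfl, w, rfl⟩
    exact ⟨w, by simp⟩
  | succ i =>
    constructor
    · rintro ⟨t, ht⟩
      obtain ⟨y, rfl⟩ := one_tmul_surjective p _ t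
      obtain ⟨w, hw⟩ := (one_tmul_eq_zero_iff p (x - d i y)).1 (by
        rw [TensorProduct.tmul_sub, ← ht, ← modpD_one_tmul, sub_self])
      exact ⟨d i y, ⟨y, rfl⟩, w, by rw [hw]; abel⟩
    · rintro ⟨_, ⟨y, rfl⟩, w, rfl⟩
      refine ⟨(1 : ZMod p) ⊗ₜ y, ?_⟩
      rw [modpD_one_tmul, TensorProduct.tmul_add, (one_tmul_eq_zero_iff p (p • w)).2 ⟨w, rfl⟩,
        add_zero]

variable (d p) in
/-- The elements of `C i` whose differential is divisible by `p`. -/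
def modpCocycles (i : ℕ) : AddSubgroup (C i) :=
  (nsmulAddMonoidHom (α := C (i + 1)) p).range.comap (d i)

theorem mem_modpCocycles_iff {i : ℕ} {x : C i} :
    x ∈ modpCocycles d p i ↔ ∃ y, p • y = d i x := Iff.rfl

theorem ker_le_modpCocycles (i : ℕ) : (d i).ker ≤ modpCocycles d p i := fun x hx =>
  ⟨0, by simpa [eq_comm] using hx⟩

theorem one_tmul_mem_ker_modpD_iff {i : ℕ} (x : C i) :
    (1 : ZMod p) ⊗ₜ x ∈ LinearMap.ker (modpD C d p i) ↔ x ∈ modpCocycles d p i := by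
  rw [LinearMap.mem_ker, modpD_one_tmul, one_tmul_eq_zero_iff, mem_modpCocycles_iff]

variable (d p) in
/-- The map sending an element with differential divisible by `p` to its class in the
cohomology of the mod `p` reduction. -/
noncomputable def modpCohomologyMk (i : ℕ) : modpCocycles d p i →+ modpCohomology C d p i :=
  ((modpCoboundaries C d p i).comap
    (LinearMap.ker (modpD C d p i)).subtype).mkQ.toAddMonoidHom.comp
    (AddMonoidHom.mk' (fun x => ⟨(1 : ZMod p) ⊗ₜ (x : C i), (one_tmul_mem_ker_modpD_iff _).2 x.2⟩)
      fun _ _ => Subtype.ext (TensorProduct.tmul_add _ _ _))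

theorem modpCohomologyMk_surjective (i : ℕ) : Function.Surjective (modpCohomologyMk d p i) := by
  refine (Submodule.mkQ_surjective _).comp ?_
  rintro ⟨t, ht⟩
  obtain ⟨x, rfl⟩ := one_tmul_surjective p _ t
  exact ⟨⟨x, (one_tmul_mem_ker_modpD_iff x).1 ht⟩, rfl⟩

theorem modpCohomologyMk_eq_zero_iff {i : ℕ} (x : modpCocycles d p i) :
    modpCohomologyMk d p i x = 0 ↔ ∃ b ∈ coboundaries C d i, ∃ w, (x : C i) = b + p • w :=
  (Submodule.Quotient.mk_eq_zero _).trans (one_tmul_mem_modpCoboundaries_iff _)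

theorem exists_cocycle_nsmul_eq (hdd : ∀ i (x : C i), d (i + 1) (d i x) = 0)
    (htf : ∀ i (x : C i), p • x = 0 → x = 0) (i : ℕ) (x : modpCocycles d p i) :
    ∃ z : (d (i + 1)).ker, p • (z : C (i + 1)) = d i x := by
  obtain ⟨y, hy⟩ := mem_modpCocycles_iff.1 x.2
  exact ⟨⟨y, htf _ _ (by rw [← map_nsmul, hy, hdd])⟩, hy⟩

/-- The connecting map of the Bockstein sequence, on representatives: `x` is sent to the class
of the cocycle `z` with `p • z = d x`. -/
theorem exists_bockstein (hdd : ∀ i (x : C i), d (i + 1) (d i x) = 0)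
    (htf : ∀ i (x : C i), p • x = 0 → x = 0) (i : ℕ) :
    ∃ ψ : modpCocycles d p i →+ cohomology C d (i + 1),
      ∀ (x : modpCocycles d p i) (z : (d (i + 1)).ker),
        p • (z : C (i + 1)) = d i x → ψ x = cohomologyMk d (i + 1) z := by
  have hinj (y y' : C (i + 1)) (h : p • y = p • y') : y = y' :=
    sub_eq_zero.1 (htf _ _ (by rw [nsmul_sub, h, sub_self]))
  choose δ hδ using exists_cocycle_nsmul_eq (d := d) hdd htf i
  refine ⟨(cohomologyMk d (i + 1)).comp (AddMonoidHom.mk' δ fun x y => Subtype.ext <| hinj _ _ ?_),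
    fun x z hz => congr_arg (cohomologyMk d (i + 1)) <| Subtype.ext <| hinj _ _ ?_⟩
  · simp [hδ]
  · exact (hδ x).trans hz.symm

theorem natCard_modpCohomology (hdd : ∀ i (x : C i), d (i + 1) (d i x) = 0)
    (htf : ∀ i (x : C i), p • x = 0 → x = 0) (i : ℕ) :
    Nat.card (modpCohomology C d p i) =
      (nsmulAddMonoidHom (α := cohomology C d i) p).range.index *
        Nat.card (nsmulAddMonoidHom (α := cohomology C d (i + 1)) p).ker := by
  have hinj (j : ℕ) (y y' : C j) (h : p • y = p • y') : y = y' :=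
    sub_eq_zero.1 (htf _ _ (by rw [nsmul_sub, h, sub_self]))
  obtain ⟨ψ, hψ⟩ := exists_bockstein hdd htf i
  have hdiv := exists_cocycle_nsmul_eq (d := d) hdd htf i
  set φ := modpCohomologyMk d p i
  let ι : (d i).ker →+ modpCocycles d p i := AddSubgroup.inclusion (ker_le_modpCocycles i)
  have hrange : ψ.range = (nsmulAddMonoidHom (α := cohomology C d (i + 1)) p).ker := by
    ext c
    obtain ⟨z, rfl⟩ := cohomologyMk_surjective (d := d) (i + 1) c
    rw [AddMonoidHom.mem_ker, nsmulAddMonoidHom_apply, ← map_nsmul, cohomologyMk_eq_zero_iff]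
    constructor
    · rintro ⟨x, hx⟩
      obtain ⟨z', hz'⟩ := hdiv x
      rw [hψ x z' hz', ← sub_eq_zero, ← map_sub, cohomologyMk_eq_zero_iff] at hx
      obtain ⟨w, hw⟩ := hx
      refine ⟨(x : C i) - p • w, ?_⟩
      rw [map_sub, map_nsmul, hw, ← hz']
      simp [nsmul_sub]
    · rintro ⟨x, hx⟩
      exact ⟨⟨x, z, hx.symm⟩, hψ _ _ hx.symm⟩
  have hker : ψ.ker = ι.range ⊔ φ.ker := by
    ext x
    rw [AddMonoidHom.mem_ker, AddSubgroup.mem_sup]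
    obtain ⟨z, hz⟩ := hdiv x
    rw [hψ x z hz, cohomologyMk_eq_zero_iff]
    constructor
    · rintro ⟨w, hw⟩
      have hw' : p • w ∈ modpCocycles d p i := ⟨d i w, by simp⟩
      refine ⟨ι ⟨x - p • w, ?_⟩, ⟨_, rfl⟩, ⟨p • w, hw'⟩, ?_, ?_⟩
      · rw [AddMonoidHom.mem_ker, map_sub, map_nsmul, hw, hz, sub_self]
      · exact (modpCohomologyMk_eq_zero_iff _).2 ⟨0, zero_mem _, w, by simp⟩
      · exact Subtype.ext (by simp [ι])
    · rintro ⟨_, ⟨y, rfl⟩, k, hk, rfl⟩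
      obtain ⟨b, hb, w, hw⟩ := (modpCohomologyMk_eq_zero_iff _).1 hk
      refine ⟨w, hinj _ _ _ ?_⟩
      have hy : d i y = 0 := y.2
      have hb' : d i b = 0 := coboundaries_le_ker hdd i hb
      rw [hz]
      simp [ι, hy, hw, hb']
  have hcomap : φ.ker.comap ι =
      (nsmulAddMonoidHom (α := cohomology C d i) p).range.comap (cohomologyMk d i) := by
    ext z
    rw [AddSubgroup.mem_comap, AddMonoidHom.mem_ker, modpCohomologyMk_eq_zero_iff,
      AddSubgroup.mem_comap]
    constructor
    · rintro ⟨b, hb, w, hw⟩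
      have hb' : d i b = 0 := coboundaries_le_ker hdd i hb
      have hz : d i z = 0 := z.2
      have hw' : d i w = 0 := htf _ _ (by
        rw [← map_nsmul, ← zero_add (d i _), ← hb', ← map_add, ← hw]
        exact hz.trans hb'.symm)
      refine ⟨cohomologyMk d i ⟨w, hw'⟩, ?_⟩
      rw [nsmulAddMonoidHom_apply, ← map_nsmul, eq_comm, ← sub_eq_zero, ← map_sub,
        cohomologyMk_eq_zero_iff]
      have : (z : C i) = b + p • w := hw
      simpa [this] using hb
    · rintro ⟨c, hc⟩
      obtain ⟨w, rfl⟩ := cohomologyMk_surjective i c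
      rw [nsmulAddMonoidHom_apply, ← map_nsmul, eq_comm, ← sub_eq_zero, ← map_sub,
        cohomologyMk_eq_zero_iff] at hc
      exact ⟨_, hc, w, by simp [ι]⟩
  have hle : φ.ker ≤ ψ.ker := hker ▸ le_sup_right
  calc Nat.card (modpCohomology C d p i) = φ.ker.index := by
        rw [AddSubgroup.index_ker, AddMonoidHom.range_eq_top.2 (modpCohomologyMk_surjective i),
          AddSubgroup.card_top]
    _ = φ.ker.relIndex ψ.ker * ψ.ker.index := (AddSubgroup.relIndex_mul_index hle).symm
    _ = _ := by
        rw [AddSubgroup.index_ker ψ, hrange, hker, AddSubgroup.relIndex_sup_right,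
          ← AddSubgroup.index_comap, hcomap,
          AddSubgroup.index_comap_of_surjective _ (cohomologyMk_surjective i)]

theorem ker_nsmul_cohomology_zero_eq_bot (htf : ∀ x : C 0, p • x = 0 → x = 0) :
    (nsmulAddMonoidHom (α := cohomology C d 0) p).ker = ⊥ := by
  refine (AddSubgroup.eq_bot_iff_forall _).2 fun c hc => ?_
  obtain ⟨z, rfl⟩ := cohomologyMk_surjective 0 c
  rw [AddMonoidHom.mem_ker, nsmulAddMonoidHom_apply, ← map_nsmul, cohomologyMk_eq_zero_iff] at hc
  exact (cohomologyMk_eq_zero_iff z).2 (htf _ hc)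

theorem subsingleton_cohomology {i : ℕ} [Subsingleton (C i)] : Subsingleton (cohomology C d i) :=
  (cohomologyMk_surjective i).subsingleton

end CochainComplex

theorem sum_range_neg_one_pow_mul_add_succ {R : Type*} [CommRing R] (t : ℕ → R) (n : ℕ) :
    ∑ i ∈ Finset.range (n + 1), (-1) ^ i * (t i + t (i + 1)) = t 0 + (-1) ^ n * t (n + 1) := by
  induction n with
  | zero => simp
  | succ n ih =>
    rw [Finset.sum_range_succ, ih]
    ring

/-- Let `p` be prime and `C` a cochain complex of abelian groups with
`C^i = 0` for `i > n`, each `C^i` without `p`-torsion, and each `H^i(C)` finitely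
generated.  Then each `H^i(C ⊗_ℤ 𝔽_p)` is a finite-dimensional `𝔽_p`-vector space and
`Σ_i (-1)^i dim_ℚ (H^i(C) ⊗_ℤ ℚ) = Σ_i (-1)^i dim_{𝔽_p} H^i(C ⊗_ℤ 𝔽_p)`. -/
theorem stmt_3 (p : ℕ) [Fact p.Prime] (n : ℕ)
    (C : ℕ → Type) [∀ i, AddCommGroup (C i)] (d : ∀ i, C i →+ C (i + 1))
    (hdd : ∀ i (x : C i), d (i + 1) (d i x) = 0)
    (hvanish : ∀ i, n < i → Subsingleton (C i))
    (htf : ∀ i (x : C i), p • x = 0 → x = 0)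
    (hfg : ∀ i, AddGroup.FG (cohomology C d i)) :
    (∀ i, FiniteDimensional (ZMod p) (modpCohomology C d p i)) ∧
      ∑ i ∈ Finset.range (n + 1),
          (-1 : ℤ) ^ i * finrank ℚ (ℚ ⊗[ℤ] cohomology C d i) =
        ∑ i ∈ Finset.range (n + 1),
          (-1 : ℤ) ^ i * finrank (ZMod p) (modpCohomology C d p i) := by
  have hp : p ≠ 0 := NeZero.ne p
  choose t ht using fun i => exists_natCard_ker_nsmul_eq_pow (cohomology C d i) p
  have hcard (i : ℕ) : Nat.card (modpCohomology C d p i) =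
      p ^ (finrank ℚ (ℚ ⊗[ℤ] cohomology C d i) + t i + t (i + 1)) := by
    rw [natCard_modpCohomology hdd htf, index_range_nsmul_of_fg _ hp, ht, ht, pow_add, pow_add]
  have hfin (i : ℕ) : Finite (modpCohomology C d p i) :=
    Nat.finite_of_card_ne_zero (by rw [hcard]; exact pow_ne_zero _ hp)
  have hfd (i : ℕ) : FiniteDimensional (ZMod p) (modpCohomology C d p i) :=
    Module.Finite.of_finite
  have hrank (i : ℕ) : finrank (ZMod p) (modpCohomology C d p i) =
      finrank ℚ (ℚ ⊗[ℤ] cohomology C d i) + t i + t (i + 1) := by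
    refine Nat.pow_right_injective (Fact.out : p.Prime).two_le ?_
    dsimp only
    rw [← hcard, Module.natCard_eq_pow_finrank (K := ZMod p), Nat.card_zmod]
  have ht_zero (i : ℕ) (h : (nsmulAddMonoidHom (α := cohomology C d i) p).ker = ⊥) : t i = 0 := by
    refine Nat.pow_right_injective (Fact.out : p.Prime).two_le ?_
    dsimp only
    rw [← ht, h, AddSubgroup.card_bot, pow_zero]
  have h_first : t 0 = 0 := ht_zero 0 (ker_nsmul_cohomology_zero_eq_bot (htf 0))
  have h_last : t (n + 1) = 0 := by
    have := hvanish (n + 1) n.lt_succ_self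
    have := subsingleton_cohomology (d := d) (i := n + 1)
    exact ht_zero _ (Subsingleton.elim _ _)
  refine ⟨hfd, ?_⟩
  have hsum := sum_range_neg_one_pow_mul_add_succ (fun i => (t i : ℤ)) n
  simp only [h_first, h_last, Nat.cast_zero, mul_zero, add_zero] at hsum
  simp_rw [hrank, Nat.cast_add, add_assoc, mul_add _ (finrank ℚ _ : ℤ), Finset.sum_add_distrib]
  rw [hsum, add_zero]
end

section
/- Let X be a Hausdorff topological space with a continuous action of a finite group G. For i = 1, …, |G| define X^i = ⋃_{H ≤ G, |H| ≥ i} X^H (with X^{|G|+1} = ∅). Then each X^i is closed in X, the set difference X^i \ X^{i+1} equals the union ⋃_{H ≤ G, |H| = i} X_H, and for every subgroup H with |H| = i the set X_H is both open and closed in the subspace X^i \ X^{i+1}. -/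
theorem isClosed_setOf_forall_mem_smul_eq {G X : Type*} [Group G] [TopologicalSpace X]
    [T2Space X] [MulAction G X] (hcont : ∀ g : G, Continuous fun x : X => g • x)
    (H : Subgroup G) : IsClosed {x : X | ∀ h ∈ H, h • x = x} := by
  simp only [Set.ofPred_forall]
  exact isClosed_iInter fun h => isClosed_iInter fun _ => isClosed_eq (hcont h) continuous_id

theorem mem_iUnion_fixed_iff_le_card_stabilizer {G X : Type*} [Group G] [Finite G]
    [MulAction G X] (i : ℕ) (x : X) :
    x ∈ (⋃ (H : Subgroup G) (_ : i ≤ Nat.card H), {x : X | ∀ h ∈ H, h • x = x}) ↔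
      i ≤ Nat.card (MulAction.stabilizer G x) := by
  simp only [Set.mem_iUnion, Set.mem_ofPred_eq, exists_prop]
  constructor
  · rintro ⟨H, hi, hH⟩
    exact hi.trans (Subgroup.card_le_of_le fun h hh => hH h hh)
  · exact fun hi => ⟨_, hi, fun h hh => hh⟩

/-- For `X` Hausdorff with a continuous action of a finite group `G`,
define `X^i = ⋃_{H ≤ G, |H| ≥ i} X^H`.  Each `X^i` is closed, the difference
`X^i \ X^{i+1}` is the union of the sets `X_H` over subgroups `H` with `|H| = i`,
and each such `X_H` is clopen in the subspace `X^i \ X^{i+1}`. -/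
theorem stmt_8 {G : Type*} [Group G] [Finite G] {X : Type*} [TopologicalSpace X]
    [T2Space X] [MulAction G X] (hcont : ∀ g : G, Continuous fun x : X => g • x)
    (Xi : ℕ → Set X)
    (hXi : ∀ i, Xi i = ⋃ (H : Subgroup G) (_ : i ≤ Nat.card H), {x : X | ∀ h ∈ H, h • x = x})
    (i : ℕ) (hi1 : 1 ≤ i) (hi2 : i ≤ Nat.card G) :
    IsClosed (Xi i) ∧
      ((Xi i \ Xi (i + 1)) =
        ⋃ (H : Subgroup G) (_ : Nat.card H = i), {x : X | MulAction.stabilizer G x = H}) ∧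
      (∀ H : Subgroup G, Nat.card H = i →
        IsClopen {x : (Xi i \ Xi (i + 1) : Set X) | MulAction.stabilizer G (x : X) = H}) := by
  have hmem : ∀ j x, x ∈ Xi j ↔ j ≤ Nat.card (MulAction.stabilizer G x) := fun j x => by
    rw [hXi, mem_iUnion_fixed_iff_le_card_stabilizer]
  have hdiff : ∀ x, x ∈ Xi i \ Xi (i + 1) ↔ Nat.card (MulAction.stabilizer G x) = i := fun x => by
    rw [Set.mem_sdiff, hmem, hmem]
    omega
  have hclosed : ∀ H : Subgroup G, Nat.card H = i →
      IsClosed {x : (Xi i \ Xi (i + 1) : Set X) | MulAction.stabilizer G (x : X) = H} := by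
    intro H hH
    convert (isClosed_setOf_forall_mem_smul_eq hcont H).preimage
      (continuous_subtype_val (p := fun x => x ∈ Xi i \ Xi (i + 1))) using 1
    ext x
    refine ⟨fun hx h hh => ?_, fun hx => ?_⟩
    · rw [← (hx : MulAction.stabilizer G (x : X) = H)] at hh
      exact hh
    · exact (Subgroup.eq_of_le_of_card_ge (fun h hh => hx h hh)
        (((hdiff x).1 x.2).trans hH.symm).le).symm
  refine ⟨?_, ?_, fun H hH => ⟨hclosed H hH, ?_⟩⟩
  · rw [hXi]
    exact isClosed_iUnion_of_finite fun H => isClosed_iUnion_of_finite fun _ =>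
      isClosed_setOf_forall_mem_smul_eq hcont H
  · ext x
    rw [hdiff]
    simp
  · rw [← isClosed_compl_iff]
    have hcompl : {x : (Xi i \ Xi (i + 1) : Set X) | MulAction.stabilizer G (x : X) = H}ᶜ =
        ⋃ (K : Subgroup G) (_ : Nat.card K = i ∧ K ≠ H),
          {x : (Xi i \ Xi (i + 1) : Set X) | MulAction.stabilizer G (x : X) = K} := by
      ext x
      simp only [Set.mem_compl_iff, Set.mem_iUnion, Set.mem_ofPred_eq, exists_prop]
      exact ⟨fun hx => ⟨_, ⟨(hdiff x).1 x.2, hx⟩, rfl⟩, by rintro ⟨K, ⟨_, hne⟩, rfl⟩; exact hne⟩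
    rw [hcompl]
    exact isClosed_iUnion_of_finite fun K => isClosed_iUnion_of_finite fun hK => hclosed K hK.1
end
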